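/- Let G be a locally triangle-free graph in W₂ with α(G) ≥ 3 that is not a join of two proper subgraphs, containing a triangle (abc), and set A = N_G(a) \ N_G[b]. If A is an independent set of G, then N_G(a) ∩ N_G(b) = {c}, and |A| = α(G) − 1. -/

import Mathlib

open Set

variable {V : Type*}

/-- `S` is an independent set of `G` contained in the vertex subset `W`
(i.e. an independent set of the induced subgraph `G[W]`). -/
def IsIndepOn (G : SimpleGraph V) (W S : Set V) : Prop :=
  S ⊆ W ∧ ∀ ⦃x⦄, x ∈ S → ∀ ⦃y⦄, y ∈ S → ¬ G.Adj x y

/-- `S` is a maximal independent set of the induced subgraph `G[W]`. -/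
def MaxIndepOn (G : SimpleGraph V) (W : Set V) (S : Finset V) : Prop :=
  IsIndepOn G W ↑S ∧ ∀ v ∈ W, v ∉ S → ¬ IsIndepOn G W (insert v ↑S)

/-- The independence number of the induced subgraph `G[W]`. -/
noncomputable def indepNumOn (G : SimpleGraph V) (W : Set V) : ℕ :=
  sSup {n | ∃ S : Finset V, IsIndepOn G W ↑S ∧ S.card = n}

/-- The induced subgraph `G[W]` is well-covered: every maximal independent set
has cardinality equal to the independence number. -/
def WellCoveredOn (G : SimpleGraph V) (W : Set V) : Prop :=
  ∀ S : Finset V, MaxIndepOn G W S → S.card = indepNumOn G W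

/-- The independence number `α(G)`. -/
noncomputable def indepNum (G : SimpleGraph V) : ℕ := indepNumOn G Set.univ

/-- `G` is well-covered. -/
def WellCovered (G : SimpleGraph V) : Prop := WellCoveredOn G Set.univ

/-- The induced subgraph `G[W]` has no isolated vertices. -/
def NoIsolatedOn (G : SimpleGraph V) (W : Set V) : Prop :=
  ∀ v ∈ W, ∃ u ∈ W, G.Adj v u

/-- The induced subgraph `G[W]` is in the class `W₂`: it has no isolated
vertices, is well-covered, and removing any vertex leaves a well-covered graph
with the same independence number. -/
def W2On (G : SimpleGraph V) (W : Set V) : Prop :=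
  NoIsolatedOn G W ∧ WellCoveredOn G W ∧
    ∀ v ∈ W, WellCoveredOn G (W \ {v}) ∧ indepNumOn G (W \ {v}) = indepNumOn G W

/-- `G` is in the class `W₂`. -/
def W2 (G : SimpleGraph V) : Prop := W2On G Set.univ

/-- The closed neighborhood `N_G[S]` of a set of vertices `S`. -/
def nbhd (G : SimpleGraph V) (S : Set V) : Set V :=
  {v | v ∈ S ∨ ∃ u ∈ S, G.Adj u v}

/-- The vertex set of `G_S = G \ N_G[S]`. -/
def GDel (G : SimpleGraph V) (S : Set V) : Set V := Set.univ \ nbhd G S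

/-- The induced subgraph `G[W]` is triangle-free. -/
def TriangleFreeOn (G : SimpleGraph V) (W : Set V) : Prop :=
  ∀ x ∈ W, ∀ y ∈ W, ∀ z ∈ W, ¬ (G.Adj x y ∧ G.Adj y z ∧ G.Adj x z)

/-- `G` is locally triangle-free: `G_v` is triangle-free for every vertex `v`. -/
def LocallyTriangleFree (G : SimpleGraph V) : Prop :=
  ∀ v : V, TriangleFreeOn G (GDel G {v})

/-- `G` is a join of two proper (nonempty, disjoint) subgraphs. -/
def IsJoin (G : SimpleGraph V) : Prop :=
  ∃ V₁ V₂ : Set V, V₁.Nonempty ∧ V₂.Nonempty ∧ Disjoint V₁ V₂ ∧ V₁ ∪ V₂ = Set.univ ∧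
    ∀ x ∈ V₁, ∀ y ∈ V₂, G.Adj x y

theorem IsIndepOn.exists_maxIndepOn [Finite V] {G : SimpleGraph V} {W : Set V} {S : Finset V}
    (hS : IsIndepOn G W ↑S) : ∃ T : Finset V, S ⊆ T ∧ MaxIndepOn G W T := by
  classical
  obtain ⟨T, hST, hT⟩ :=
    (Set.toFinite {T : Finset V | IsIndepOn G W ↑T}).exists_le_maximal hS
  refine ⟨T, hST, hT.prop, fun v _ hvT hins => hvT ?_⟩
  have hins' : insert v T ∈ {T : Finset V | IsIndepOn G W ↑T} := by simpa using hins
  exact hT.le_of_ge hins' (Finset.subset_insert v T) (Finset.mem_insert_self v T)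

theorem WellCovered.ncard_le [Finite V] {G : SimpleGraph V} (hG : WellCovered G) {S : Set V}
    (hS : IsIndepOn G univ S) : S.ncard ≤ indepNum G := by
  obtain ⟨S, rfl⟩ := S.toFinite.exists_finset_coe
  obtain ⟨T, hST, hT⟩ := hS.exists_maxIndepOn
  rw [Set.ncard_coe_finset, indepNum, ← hG T hT]
  exact Finset.card_le_card hST

theorem WellCovered.exists_not_adj [Finite V] {G : SimpleGraph V} (hG : WellCovered G) {S : Set V}
    (hS : IsIndepOn G univ S) (hcard : S.ncard < indepNum G) :
    ∃ v ∉ S, ∀ s ∈ S, ¬ G.Adj s v := by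
  obtain ⟨S, rfl⟩ := S.toFinite.exists_finset_coe
  rw [Set.ncard_coe_finset] at hcard
  by_contra! h
  refine hcard.ne (hG S ⟨hS, fun v _ hv hins => ?_⟩)
  obtain ⟨s, hs, hsv⟩ := h v hv
  exact hins.2 (mem_insert_of_mem v hs) (mem_insert v _) hsv

/-- In a graph of class `W₂`, an independent set missing the closed neighborhood of `v` does not
dominate the neighborhood of `v`. -/
theorem W2.exists_adj_not_adj [Finite V] {G : SimpleGraph V} (hG : W2 G) {S : Set V} {v : V}
    (hS : IsIndepOn G univ S) (hvS : v ∉ S) (hv : ∀ s ∈ S, ¬ G.Adj s v) :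
    ∃ u, G.Adj v u ∧ ∀ s ∈ S, ¬ G.Adj s u := by
  classical
  by_contra! h
  obtain ⟨S, rfl⟩ := S.toFinite.exists_finset_coe
  have hins : IsIndepOn G univ ↑(insert v S) := by
    refine ⟨subset_univ _, fun x hx y hy => ?_⟩
    simp only [Finset.coe_insert, Set.mem_insert_iff] at hx hy
    rcases hx with rfl | hx <;> rcases hy with rfl | hy
    · exact G.irrefl
    · exact fun hxy => hv y hy hxy.symm
    · exact hv x hx
    · exact hS.2 hx hy
  obtain ⟨M, hSM, hM⟩ := hins.exists_maxIndepOn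
  have hvM : v ∈ M := hSM (Finset.mem_insert_self v S)
  have hmax : MaxIndepOn G (univ \ {v}) (M.erase v) := by
    refine ⟨⟨fun x hx => by simpa using (Finset.mem_erase.1 hx).1, fun x hx y hy =>
      hM.1.2 (Finset.mem_of_mem_erase hx) (Finset.mem_of_mem_erase hy)⟩, fun w hw hwM hind => ?_⟩
    have hwv : w ≠ v := hw.2
    have key : ∀ x ∈ M, x ≠ v → ¬ G.Adj x w := fun x hx hxv =>
      hind.2 (mem_insert_of_mem w (Finset.mem_erase.2 ⟨hxv, hx⟩)) (mem_insert w _)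
    have hvw : ¬ G.Adj v w := fun hvw => by
      obtain ⟨s, hs, hsw⟩ := h w hvw
      exact key s (hSM (Finset.mem_insert_of_mem hs)) (fun hsv => hvS (hsv ▸ hs)) hsw
    have hall : ∀ x ∈ M, ¬ G.Adj x w := fun x hx => by
      rcases eq_or_ne x v with rfl | hxv
      · exact hvw
      · exact key x hx hxv
    refine hM.2 w (mem_univ w) (fun hw' => hwM (Finset.mem_erase.2 ⟨hwv, hw'⟩))
      ⟨subset_univ _, fun x hx y hy => ?_⟩
    rcases hx with rfl | hx <;> rcases hy with rfl | hy
    · exact G.irrefl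
    · exact fun hxy => hall y hy hxy.symm
    · exact hall x hx
    · exact hM.1.2 hx hy
  have h1 := hG.2.1 M hM
  have h2 := (hG.2.2 v (mem_univ v)).1 _ hmax
  rw [(hG.2.2 v (mem_univ v)).2, ← h1] at h2
  exact (Finset.card_erase_lt_of_mem hvM).ne h2

/-- Every triangle of a locally triangle-free graph is dominating. -/
theorem LocallyTriangleFree.adj_of_triangle {G : SimpleGraph V} (hG : LocallyTriangleFree G)
    {x y z : V} (hxy : G.Adj x y) (hyz : G.Adj y z) (hxz : G.Adj x z) (w : V) :
    G.Adj w x ∨ G.Adj w y ∨ G.Adj w z := by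
  by_contra! h
  obtain ⟨hx, hy, hz⟩ := h
  have mem : ∀ u, ¬ G.Adj w u → u ≠ w → u ∈ GDel G {w} := fun u hu huw => by
    simp [GDel, nbhd, hu, huw]
  refine hG w x (mem x hx ?_) y (mem y hy ?_) z (mem z hz ?_) ⟨hxy, hyz, hxz⟩
  · rintro rfl; exact hy hxy
  · rintro rfl; exact hx hxy.symm
  · rintro rfl; exact hx hxz.symm

theorem exists_not_adj_of_not_isJoin {G : SimpleGraph V} (hG : ¬ IsJoin G) {P : Set V}
    (hP : P.Nonempty) (hP' : Pᶜ.Nonempty) : ∃ p ∈ P, ∃ q ∉ P, ¬ G.Adj p q := by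
  by_contra! h
  exact hG ⟨P, Pᶜ, hP, hP', disjoint_compl_right, union_compl_self P, h⟩

theorem mem_neighborSet_diff_nbhd {G : SimpleGraph V} {a b v : V} :
    v ∈ G.neighborSet a \ nbhd G {b} ↔ G.Adj a v ∧ ¬ G.Adj b v ∧ v ≠ b := by
  simp only [nbhd, mem_sdiff, SimpleGraph.mem_neighborSet, mem_ofPred_eq, mem_singleton_iff,
    exists_eq_left]
  tauto

section Triangle

variable [Finite V] {G : SimpleGraph V} {A : Set V} {a b : V}

/-- If `N(a) \ N[b]` is independent, it dominates the vertices outside `N[a] ∪ N[b]`. -/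
theorem exists_adj_of_not_adj (h2 : W2 G) (hloc : LocallyTriangleFree G) (hjoin : ¬ IsJoin G)
    (hab : G.Adj a b) (hC : ∃ c, G.Adj a c ∧ G.Adj b c)
    (hA : ∀ v, v ∈ A ↔ G.Adj a v ∧ ¬ G.Adj b v ∧ v ≠ b)
    (hind : ∀ x ∈ A, ∀ y ∈ A, ¬ G.Adj x y)
    {d : V} (hda : ¬ G.Adj a d) (hdb : ¬ G.Adj b d) : ∃ t ∈ A, G.Adj t d := by
  have irr : ∀ v, ¬ G.Adj v v := fun v => G.irrefl
  have sym : ∀ u v, G.Adj u v → G.Adj v u := fun u v h => h.symm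
  by_contra! hd
  obtain ⟨d', hdd', hd'⟩ := h2.exists_adj_not_adj (S := insert b A) (v := d)
    ⟨subset_univ _, by grind⟩ (by grind) (by grind)
  have hd'a : ¬ G.Adj a d' := by grind
  have hd'b : ¬ G.Adj b d' := by grind
  obtain ⟨c₀, hc₀⟩ := hC
  obtain ⟨c, hc, x, hx, hcx⟩ := exists_not_adj_of_not_isJoin hjoin
    (P := {c | G.Adj a c ∧ G.Adj b c}) ⟨c₀, hc₀⟩ ⟨a, fun h => irr a h.1⟩
  have hac : G.Adj a c := hc.1
  have hbc : G.Adj b c := hc.2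
  have hCD : ∀ c, G.Adj a c → G.Adj b c → ∀ v, ¬ G.Adj a v → ¬ G.Adj b v → G.Adj c v :=
    fun c h h' v _ _ => by grind [hloc.adj_of_triangle hab h' h v]
  have hAc : ∀ t ∈ A, G.Adj t c := fun t ht => by
    grind [hloc.adj_of_triangle hdd' (hCD c hac hbc d' hd'a hd'b).symm
      (hCD c hac hbc d hda hdb).symm t]
  have hx' : ¬ (G.Adj a x ∧ G.Adj b x) := hx
  have hxb : G.Adj b x ∧ ¬ G.Adj a x := by grind
  have hxA : ∀ t ∈ A, G.Adj t x := fun t ht => by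
    grind [hloc.adj_of_triangle ((hA t).1 ht).1 (hAc t ht) hac x]
  have hxD : ∀ v, ¬ G.Adj a v → ¬ G.Adj b v → G.Adj v x := fun v hva hvb => by
    by_contra hvx
    have hvne : v ≠ a := by grind
    have hxne : x ≠ a := by grind
    obtain ⟨u, hau, hu⟩ := h2.exists_adj_not_adj (S := {x, v}) (v := a)
      ⟨subset_univ _, by grind⟩ (by grind) (by grind)
    have hux := hu x (by simp)
    have huv := hu v (by simp)
    by_cases hub : G.Adj b u
    · exact huv (hCD u hau hub v hva hvb).symm
    · grind
  grind [hloc.adj_of_triangle hdd' (hxD d' hd'a hd'b) (hxD d hda hdb) a]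

theorem exists_private_neighbor (h2 : W2 G)
    (hA : ∀ v, v ∈ A ↔ G.Adj a v ∧ ¬ G.Adj b v ∧ v ≠ b)
    (hind : ∀ x ∈ A, ∀ y ∈ A, ¬ G.Adj x y) {t : V} (ht : t ∈ A) :
    ∃ d, G.Adj t d ∧ ¬ G.Adj a d ∧ ¬ G.Adj b d ∧ ∀ s ∈ A, s ≠ t → ¬ G.Adj s d := by
  have irr : ∀ v, ¬ G.Adj v v := fun v => G.irrefl
  have sym : ∀ u v, G.Adj u v → G.Adj v u := fun u v h => h.symm
  obtain ⟨d, htd, hd⟩ := h2.exists_adj_not_adj (S := insert b (A \ {t})) (v := t)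
    ⟨subset_univ _, by grind⟩ (by grind) (by grind)
  refine ⟨d, htd, ?_, ?_, ?_⟩ <;> grind

/-- A neighbor `c` of `a` that is complete to `N(a) \ N[b]` is adjacent to every neighbor of `b`
outside `N[a]`. -/
theorem adj_of_complete (h2 : W2 G) (hloc : LocallyTriangleFree G) (hα : 3 ≤ indepNum G)
    (hab : G.Adj a b)
    (hA : ∀ v, v ∈ A ↔ G.Adj a v ∧ ¬ G.Adj b v ∧ v ≠ b)
    (hind : ∀ x ∈ A, ∀ y ∈ A, ¬ G.Adj x y) (hne : A.Nonempty)
    {c : V} (hac : G.Adj a c) (hcA : ∀ t ∈ A, G.Adj t c)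
    {x : V} (hxa : ¬ G.Adj a x) (hxb : G.Adj b x) (hxne : x ≠ a) : G.Adj c x := by
  have irr : ∀ v, ¬ G.Adj v v := fun v => G.irrefl
  have sym : ∀ u v, G.Adj u v → G.Adj v u := fun u v h => h.symm
  have hCD : ∀ c, G.Adj a c → G.Adj b c → ∀ v, ¬ G.Adj a v → ¬ G.Adj b v → G.Adj c v :=
    fun c h h' v _ _ => by grind [hloc.adj_of_triangle hab h' h v]
  have hBA : ∀ x, ¬ G.Adj a x → ¬ G.Adj c x → ∀ t ∈ A, G.Adj t x := fun x _ _ t ht => by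
    grind [hloc.adj_of_triangle ((hA t).1 ht).1 (hcA t ht) hac x]
  have hBD : ∀ x, ¬ G.Adj a x → ¬ G.Adj c x → G.Adj b x → x ≠ a →
      ∀ v, ¬ G.Adj a v → ¬ G.Adj b v → G.Adj v x := fun x hxa hcx hxb hxne v hva hvb => by
    by_contra hvx
    have hvne : v ≠ a := by grind
    obtain ⟨u, hau, hu⟩ := h2.exists_adj_not_adj (S := {x, v}) (v := a)
      ⟨subset_univ _, by grind⟩ (by grind) (by grind)
    have hux := hu x (by simp)
    have huv := hu v (by simp)
    by_cases hub : G.Adj b u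
    · exact huv (hCD u hau hub v hva hvb).symm
    · grind
  by_contra hcx
  have hxD := hBD x hxa hcx hxb hxne
  have hDind : ∀ d d', ¬ G.Adj a d → ¬ G.Adj b d → ¬ G.Adj a d' → ¬ G.Adj b d' →
      ¬ G.Adj d d' := fun d d' h₁ h₂ h₃ h₄ hdd' => by
    grind [hloc.adj_of_triangle hdd' (hxD d' h₃ h₄) (hxD d h₁ h₂) a]
  have haxind : IsIndepOn G univ {a, x} := ⟨subset_univ _, by grind⟩
  obtain ⟨y, hyS, hy⟩ := WellCovered.exists_not_adj h2.2.1 haxind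
    (by have := Set.ncard_insert_le a {x}; simp at this; omega)
  obtain ⟨z, hyz, hz⟩ := h2.exists_adj_not_adj haxind hyS hy
  have hya := hy a (by simp)
  have hyx := hy x (by simp)
  have hza := hz a (by simp)
  have hzx := hz x (by simp)
  have hyb : G.Adj b y := by grind
  have hzb : G.Adj b z := by grind
  have hyne : y ≠ a := by grind
  have hzne : z ≠ a := by grind
  have main : ∀ y z, G.Adj y z → ¬ G.Adj a y → ¬ G.Adj a z → G.Adj b y → G.Adj b z →
      y ≠ a → z ≠ a → ¬ G.Adj c y → False := fun y z hyz hya hza hyb hzb hyne hzne hcy => by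
    have hyD := hBD y hya hcy hyb hyne
    have hzD : ∀ v, ¬ G.Adj a v → ¬ G.Adj b v → ¬ G.Adj v z := fun v hva hvb hvz => by
      grind [hloc.adj_of_triangle (hyD v hva hvb) hyz hvz a]
    obtain ⟨u, hau, hu⟩ := h2.exists_adj_not_adj
      (S := insert z {v | ¬ G.Adj a v ∧ ¬ G.Adj b v}) (v := a)
      ⟨subset_univ _, by
        rintro p (rfl | ⟨hp, hp'⟩) q (rfl | ⟨hq, hq'⟩) <;> grind⟩
      (by rintro (h | ⟨_, h⟩) <;> grind) (by rintro p (rfl | ⟨hp, hp'⟩) <;> grind)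
    have huz := hu z (by simp)
    have huD : ∀ v, ¬ G.Adj a v → ¬ G.Adj b v → ¬ G.Adj v u :=
      fun v hv hv' => hu v (Or.inr ⟨hv, hv'⟩)
    obtain ⟨t, ht⟩ := hne
    by_cases hub : G.Adj b u
    · obtain ⟨d, -, hda, hdb, -⟩ := exists_private_neighbor h2 hA hind ht
      exact huD d hda hdb (hCD u hau hub d hda hdb).symm
    · obtain ⟨d, hud, hda, hdb, -⟩ := exists_private_neighbor h2 hA hind
        ((hA u).2 ⟨hau, hub, by grind⟩)
      exact huD d hda hdb hud.symm
  by_cases hcy : G.Adj c y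
  · by_cases hcz : G.Adj c z
    · grind [hloc.adj_of_triangle hcy hyz hcz x]
    · exact main z y hyz.symm hza hya hzb hyb hzne hyne hcz
  · exact main y z hyz hya hza hyb hzb hyne hzne hcy

theorem eq_of_common_neighbor (h2 : W2 G) (hloc : LocallyTriangleFree G) (hα : 3 ≤ indepNum G)
    (hjoin : ¬ IsJoin G) (hab : G.Adj a b)
    (hA : ∀ v, v ∈ A ↔ G.Adj a v ∧ ¬ G.Adj b v ∧ v ≠ b)
    (hind : ∀ x ∈ A, ∀ y ∈ A, ¬ G.Adj x y) (hcard : A.ncard + 1 = indepNum G)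
    {c c' : V} (hac : G.Adj a c) (hbc : G.Adj b c) (hac' : G.Adj a c') (hbc' : G.Adj b c') :
    c = c' := by
  have irr : ∀ v, ¬ G.Adj v v := fun v => G.irrefl
  have sym : ∀ u v, G.Adj u v → G.Adj v u := fun u v h => h.symm
  have hCD : ∀ c, G.Adj a c → G.Adj b c → ∀ v, ¬ G.Adj a v → ¬ G.Adj b v → G.Adj c v :=
    fun c h h' v _ _ => by grind [hloc.adj_of_triangle hab h' h v]
  obtain ⟨t₁, ht₁, t₂, ht₂, ht₁₂⟩ := (Set.one_lt_ncard (s := A)).1 (by omega)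
  have hCA : ∀ c, G.Adj a c → G.Adj b c → ∀ t ∈ A, G.Adj t c → ∀ s ∈ A, G.Adj s c := by
    intro c hac hbc t ht htc s hs
    obtain ⟨d, htd, hda, hdb, hd⟩ := exists_private_neighbor h2 hA hind ht
    grind [hloc.adj_of_triangle htd (hCD c hac hbc d hda hdb).symm htc s]
  have huniq : ∀ c c', G.Adj a c → G.Adj b c → G.Adj a c' → G.Adj b c' →
      (∀ t ∈ A, ¬ G.Adj t c) → (∀ t ∈ A, ¬ G.Adj t c') → c = c' := by
    intro c c' hac hbc hac' hbc' hc hc'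
    by_contra hcc'
    by_cases hadj : G.Adj c c'
    · grind [hloc.adj_of_triangle hbc hadj hbc' t₁]
    · have hle := WellCovered.ncard_le h2.2.1 (S := insert c (insert c' A))
        ⟨subset_univ _, by rintro p (rfl | rfl | hp) q (rfl | rfl | hq) <;> grind⟩
      rw [Set.ncard_insert_of_notMem (by grind), Set.ncard_insert_of_notMem (by grind)] at hle
      omega
  by_contra hcc'
  obtain ⟨e, he⟩ : ∃ e, G.Adj a e ∧ G.Adj b e ∧ ∀ t ∈ A, G.Adj t e := by
    by_contra! hno
    refine hcc' (huniq c c' hac hbc hac' hbc' ?_ ?_)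
    · intro t ht htc
      obtain ⟨s, hs, hsc⟩ := hno c hac hbc
      exact hsc (hCA c hac hbc t ht htc s hs)
    · intro t ht htc
      obtain ⟨s, hs, hsc⟩ := hno c' hac' hbc'
      exact hsc (hCA c' hac' hbc' t ht htc s hs)
  obtain ⟨p, ⟨hap, hbp, hpA⟩, q, hq, hpq⟩ := exists_not_adj_of_not_isJoin hjoin
    (P := {e | G.Adj a e ∧ G.Adj b e ∧ ∀ t ∈ A, G.Adj t e}) ⟨e, he⟩ ⟨a, fun h => irr a h.1⟩
  have hpB : ∀ x, ¬ G.Adj a x → G.Adj b x → x ≠ a → G.Adj p x := fun x =>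
    adj_of_complete h2 hloc hα hab hA hind ⟨t₁, ht₁⟩ hap hpA
  have haq : G.Adj a q := by grind
  have hbq : G.Adj b q := by
    by_contra hbq
    have hqb : q ≠ b := by rintro rfl; exact hpq hbp.symm
    exact hpq (hpA q ((hA q).2 ⟨haq, hbq, hqb⟩)).symm
  have hqA : ∀ t ∈ A, ¬ G.Adj t q := fun t ht htq => hq ⟨haq, hbq, hCA q haq hbq t ht htq⟩
  have hqt : q ≠ t₁ := by rintro rfl; exact ((hA q).1 ht₁).2.1 hbq
  obtain ⟨u, htu, hu⟩ := h2.exists_adj_not_adj (S := insert q (A \ {t₁})) (v := t₁)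
    ⟨subset_univ _, by
      rintro x (rfl | hx) y (rfl | hy) hxy
      · exact irr _ hxy
      · exact hqA y hy.1 hxy.symm
      · exact hqA x hx.1 hxy
      · exact hind x hx.1 y hy.1 hxy⟩
    (by simp [hqt.symm])
    (by
      rintro x (rfl | hx) hxt
      · exact hqA t₁ ht₁ hxt.symm
      · exact hind x hx.1 t₁ ht₁ hxt)
  have huq := hu q (by simp)
  have hut₂ := hu t₂ (Or.inr ⟨ht₂, by grind⟩)
  have hua : ¬ G.Adj a u := by
    intro hau
    by_cases hbu : G.Adj b u
    · exact hut₂ (hCA u hau hbu t₁ ht₁ htu t₂ ht₂)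
    · grind
  have hub : G.Adj b u := by
    by_contra hbu
    exact huq (hCD q haq hbq u hua hbu)
  have hpu := hpB u hua hub (by grind)
  grind [hloc.adj_of_triangle (hpA t₁ ht₁) hpu htu q]

theorem ncard_add_one_eq (h2 : W2 G) (hloc : LocallyTriangleFree G) (hjoin : ¬ IsJoin G)
    (hab : G.Adj a b) (hC : ∃ c, G.Adj a c ∧ G.Adj b c)
    (hA : ∀ v, v ∈ A ↔ G.Adj a v ∧ ¬ G.Adj b v ∧ v ≠ b)
    (hind : ∀ x ∈ A, ∀ y ∈ A, ¬ G.Adj x y) : A.ncard + 1 = indepNum G := by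
  have irr : ∀ v, ¬ G.Adj v v := fun v => G.irrefl
  have sym : ∀ u v, G.Adj u v → G.Adj v u := fun u v h => h.symm
  have hS : IsIndepOn G univ (insert b A) := ⟨subset_univ _, by grind⟩
  rw [← Set.ncard_insert_of_notMem (a := b) (s := A) (by grind)]
  by_contra hcard
  obtain ⟨v, hv, hvS⟩ := WellCovered.exists_not_adj h2.2.1 hS
    (lt_of_le_of_ne (WellCovered.ncard_le h2.2.1 hS) hcard)
  have hvb : ¬ G.Adj b v := hvS b (mem_insert b A)
  have hva : ¬ G.Adj a v := by grind
  obtain ⟨t, ht, htv⟩ := exists_adj_of_not_adj h2 hloc hjoin hab hC hA hind hva hvb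
  exact hvS t (mem_insert_of_mem b ht) htv

end Triangle

/-- If `A = N_G(a) \ N_G[b]` is independent, then `N_G(a) ∩ N_G(b) = {c}` and
`|A| = α(G) - 1`. -/
theorem stmt_15 [Fintype V] (G : SimpleGraph V) (h2 : W2 G)
    (hloc : LocallyTriangleFree G) (hα : 3 ≤ indepNum G) (hjoin : ¬ IsJoin G)
    {a b c : V} (hab : G.Adj a b) (hbc : G.Adj b c) (hac : G.Adj a c)
    (hA : IsIndepOn G Set.univ (G.neighborSet a \ nbhd G {b})) :
    G.neighborSet a ∩ G.neighborSet b = {c} ∧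
      (G.neighborSet a \ nbhd G {b}).ncard = indepNum G - 1 := by
  have hind : ∀ x ∈ G.neighborSet a \ nbhd G {b}, ∀ y ∈ G.neighborSet a \ nbhd G {b},
      ¬ G.Adj x y := fun x hx y hy => hA.2 hx hy
  have hcard := ncard_add_one_eq h2 hloc hjoin hab ⟨c, hac, hbc⟩
    (fun _ => mem_neighborSet_diff_nbhd) hind
  refine ⟨Set.ext fun v => ⟨fun hv => ?_, ?_⟩, by omega⟩
  · exact eq_of_common_neighbor h2 hloc hα hjoin hab (fun _ => mem_neighborSet_diff_nbhd) hind
      hcard hv.1 hv.2 hac hbc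
  · rintro rfl
    exact ⟨hac, hbc⟩
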